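/- Let T be a tree with p vertices consisting of q ≥ 2 disjoint subtrees of sizes r₁, …, r_q after removal of q−1 edges (i.e., a forest F with components of sizes r₁,…,r_q summing to p). The number of distinct trees on the p vertices that can be formed by adding exactly q−1 edges connecting the components of F into a single tree, with each added edge joining vertices in distinct components, is p^{q−2} · ∏_{i=1}^q r_i. -/

import Mathlib

namespace GenCayley
open SimpleGraph Finset
open scoped Classical

variable {ι : Type*} [Fintype ι]

/-- Size of the component `c`. -/
noncomputable def rs (F : SimpleGraph ι) (c : F.ConnectedComponent) : ℕ :=
  Nat.card {x : ι // F.connectedComponentMk x = c}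

lemma rs_eq (F : SimpleGraph ι) (c : F.ConnectedComponent) :
    rs F c = #{x : ι | F.connectedComponentMk x = c} := by
  simp [rs, Nat.card_eq_fintype_card, Fintype.card_subtype]

lemma rs_pos (F : SimpleGraph ι) (c : F.ConnectedComponent) : 0 < rs F c := by
  rw [rs_eq, Finset.card_pos]
  obtain ⟨x, rfl⟩ := c.exists_rep
  exact ⟨x, by simp; rfl⟩

lemma ex_mk {F : SimpleGraph ι} (c : F.ConnectedComponent) :
    ∃ x, F.connectedComponentMk x = c := c.exists_rep

lemma reach_iff (F : SimpleGraph ι) {u v : ι} (h : ¬ F.Reachable u v) (x y : ι) :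
    (F ⊔ edge u v).Reachable x y ↔ F.Reachable x y ∨ (F.Reachable x u ∧ F.Reachable v y) ∨
      (F.Reachable x v ∧ F.Reachable u y) := by
  have huv : u ≠ v := by rintro rfl; exact h (Reachable.refl _)
  have hadj : (F ⊔ edge u v).Adj u v := by simp [edge_adj, huv]
  have hle : F ≤ F ⊔ edge u v := le_sup_left
  constructor
  · rintro ⟨p⟩
    induction p with
    | nil => exact Or.inl (Reachable.refl _)
    | @cons a b c hab p ih =>
      rw [sup_adj, edge_adj] at hab
      rcases hab with hab | ⟨⟨rfl, rfl⟩ | ⟨rfl, rfl⟩, -⟩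
      · have := hab.reachable
        rcases ih with ih | ⟨h1, h2⟩ | ⟨h1, h2⟩
        · exact Or.inl (this.trans ih)
        · exact Or.inr (Or.inl ⟨this.trans h1, h2⟩)
        · exact Or.inr (Or.inr ⟨this.trans h1, h2⟩)
      · rcases ih with ih | ⟨h1, h2⟩ | ⟨h1, h2⟩
        · exact Or.inr (Or.inl ⟨Reachable.refl _, ih⟩)
        · exact absurd h1.symm h
        · exact Or.inl h2
      · rcases ih with ih | ⟨h1, h2⟩ | ⟨h1, h2⟩
        · exact Or.inr (Or.inr ⟨Reachable.refl _, ih⟩)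
        · exact Or.inl h2
        · exact absurd h1 h
  · rintro (h | ⟨h1, h2⟩ | ⟨h1, h2⟩)
    · exact h.mono hle
    · exact ((h1.mono hle).trans hadj.reachable).trans (h2.mono hle)
    · exact ((h1.mono hle).trans hadj.symm.reachable).trans (h2.mono hle)

lemma mk_iff (F : SimpleGraph ι) {u v : ι} (h : ¬ F.Reachable u v) (x y : ι) :
    (F ⊔ edge u v).connectedComponentMk x = (F ⊔ edge u v).connectedComponentMk y ↔
      F.connectedComponentMk x = F.connectedComponentMk y ∨
      (F.connectedComponentMk x = F.connectedComponentMk u ∧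
        F.connectedComponentMk y = F.connectedComponentMk v) ∨
      (F.connectedComponentMk x = F.connectedComponentMk v ∧
        F.connectedComponentMk y = F.connectedComponentMk u) := by
  simp only [ConnectedComponent.eq]
  rw [reach_iff F h, F.reachable_comm (u := v), F.reachable_comm (u := u)]

/-- Map on components. -/
def phi (F : SimpleGraph ι) (u v : ι) (c : F.ConnectedComponent) :
    (F ⊔ edge u v).ConnectedComponent :=
  c.map (Hom.ofLE le_sup_left)

@[simp] lemma phi_mk (F : SimpleGraph ι) (u v x : ι) :
    phi F u v (F.connectedComponentMk x) = (F ⊔ edge u v).connectedComponentMk x := rfl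

lemma phi_inj (F : SimpleGraph ι) {u v : ι} (h : ¬ F.Reachable u v)
    [Fintype F.ConnectedComponent] :
    Set.InjOn (phi F u v) (univ.erase (F.connectedComponentMk v) : Finset _) := by
  intro a ha b hb hab
  obtain ⟨x, rfl⟩ := ex_mk a
  obtain ⟨y, rfl⟩ := ex_mk b
  simp only [phi_mk, mk_iff F h] at hab
  simp at ha hb
  grind [ConnectedComponent.eq]

lemma phi_surj (F : SimpleGraph ι) {u v : ι} (h : ¬ F.Reachable u v)
    [Fintype F.ConnectedComponent] :
    Set.SurjOn (phi F u v) (univ.erase (F.connectedComponentMk v) : Finset _) Set.univ := by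
  intro a _
  obtain ⟨x, rfl⟩ := ex_mk a
  by_cases hx : F.connectedComponentMk x = F.connectedComponentMk v
  · refine ⟨F.connectedComponentMk u, by simpa using h, ?_⟩
    rw [phi_mk, mk_iff F h]; simp [hx]
  · exact ⟨F.connectedComponentMk x, by simpa using hx, rfl⟩

lemma card_merge (F : SimpleGraph ι) {u v : ι} (h : ¬ F.Reachable u v)
    [Fintype F.ConnectedComponent] [Fintype (F ⊔ edge u v).ConnectedComponent] :
    Fintype.card F.ConnectedComponent = Fintype.card (F ⊔ edge u v).ConnectedComponent + 1 := by
  have : #(univ.erase (F.connectedComponentMk v)) =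
      #(univ : Finset (F ⊔ edge u v).ConnectedComponent) :=
    Finset.card_nbij (phi F u v) (fun _ _ => mem_univ _) (phi_inj F h)
      (by simpa using phi_surj F h)
  rw [← Finset.card_univ, ← Finset.card_univ, ← this, Finset.card_erase_add_one (mem_univ _)]

lemma prod_merge (F : SimpleGraph ι) {u v : ι} (h : ¬ F.Reachable u v)
    [Fintype F.ConnectedComponent] [Fintype (F ⊔ edge u v).ConnectedComponent] :
    rs F (F.connectedComponentMk u) * rs F (F.connectedComponentMk v) *
      ∏ c, rs (F ⊔ edge u v) c =
    (rs F (F.connectedComponentMk u) + rs F (F.connectedComponentMk v)) * ∏ c, rs F c := by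
  have hne : F.connectedComponentMk u ≠ F.connectedComponentMk v := by simpa using h
  have h1 : ∏ c ∈ univ.erase (F.connectedComponentMk v), rs (F ⊔ edge u v) (phi F u v c) =
      ∏ c, rs (F ⊔ edge u v) c :=
    Finset.prod_nbij (phi F u v) (fun _ _ => mem_univ _) (phi_inj F h)
      (by simpa using phi_surj F h) (fun _ _ => rfl)
  have hu : F.connectedComponentMk u ∈ univ.erase (F.connectedComponentMk v) := by simpa using h
  have h2 : rs (F ⊔ edge u v) (phi F u v (F.connectedComponentMk u)) =
      rs F (F.connectedComponentMk u) + rs F (F.connectedComponentMk v) := by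
    rw [rs_eq, rs_eq, rs_eq, ← card_union_of_disjoint]
    · congr 1
      ext x
      simp only [phi_mk, mem_filter, mem_univ, true_and, mem_union, mk_iff F h]
      tauto
    · rw [Finset.disjoint_left]
      intro x hx hx'
      simp only [mem_filter, mem_univ, true_and] at hx hx'
      exact hne (hx.symm.trans hx')
  have h3 : ∏ c ∈ (univ.erase (F.connectedComponentMk v)).erase (F.connectedComponentMk u),
      rs (F ⊔ edge u v) (phi F u v c) =
      ∏ c ∈ (univ.erase (F.connectedComponentMk v)).erase (F.connectedComponentMk u), rs F c := by
    refine prod_congr rfl fun c hc => ?_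
    obtain ⟨y, rfl⟩ := ex_mk c
    rw [rs_eq, rs_eq]
    congr 1
    ext x
    simp only [mem_erase, mem_univ, and_true] at hc
    simp only [phi_mk, mem_filter, mem_univ, true_and, mk_iff F h]
    tauto
  rw [← h1, ← mul_prod_erase _ _ hu, h2, h3, ← mul_prod_erase univ _ (mem_univ (F.connectedComponentMk v)),
    ← mul_prod_erase (univ.erase (F.connectedComponentMk v)) _ hu]
  ring

/-- Number of ordered adjacent pairs. -/
lemma adj_count (G : SimpleGraph ι) :
    #{p : ι × ι | G.Adj p.1 p.2} = 2 * #G.edgeFinset := by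
  rw [← sum_degrees_eq_twice_card_edges, ← Finset.univ_product_univ, Finset.card_filter,
    Finset.sum_product]
  refine sum_congr rfl fun x _ => ?_
  rw [← Finset.card_filter, ← card_neighborFinset_eq_degree]
  congr 1
  ext y; simp

lemma conn_of_card_one (F : SimpleGraph ι) [Fintype F.ConnectedComponent]
    (h : Fintype.card F.ConnectedComponent = 1) : F.Connected := by
  obtain ⟨c, hc⟩ := Fintype.card_eq_one_iff.1 h
  have : Nonempty ι := ⟨c.exists_rep.choose⟩
  refine ⟨fun x y => ?_⟩
  exact ConnectedComponent.eq.1 ((hc _).trans (hc _).symm)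

lemma exists_not_reach (F : SimpleGraph ι) [Fintype F.ConnectedComponent]
    (h : 1 < Fintype.card F.ConnectedComponent) : ∃ u v, ¬ F.Reachable u v := by
  obtain ⟨a, b, hab⟩ := Fintype.exists_pair_of_one_lt_card h
  obtain ⟨x, rfl⟩ := ex_mk a
  obtain ⟨y, rfl⟩ := ex_mk b
  exact ⟨x, y, fun h' => hab (ConnectedComponent.eq.2 h')⟩

lemma edges_forest (n : ℕ) : ∀ (F : SimpleGraph ι) [Fintype F.ConnectedComponent],
    F.IsAcyclic → Fintype.card F.ConnectedComponent = n + 1 →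
    #F.edgeFinset + (n + 1) = Fintype.card ι := by
  induction n with
  | zero =>
    intro F _ hF h
    exact IsTree.card_edgeFinset ⟨conn_of_card_one F h, hF⟩
  | succ n ih =>
    intro F _ hF h
    obtain ⟨u, v, huv⟩ := exists_not_reach F (by omega)
    have : Fintype (F ⊔ edge u v).ConnectedComponent := Fintype.ofFinite _
    have h1 := ih (F ⊔ edge u v) (hF.sup_edge_of_not_reachable huv)
      (by have := card_merge F huv; omega)
    have h2 := F.card_edgeFinset_sup_edge (s := u) (t := v) (fun h => huv h.reachable)
      (by rintro rfl; exact huv (Reachable.refl _))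
    have h3 : #(F ⊔ edge u v).edgeFinset = #F.edgeFinset + 1 := by convert h2
    have h4 : #(F ⊔ edge u v).edgeFinset + (n + 1) = Fintype.card ι := by convert h1
    omega

/-- Trees containing `F`. -/
noncomputable def NT (F : SimpleGraph ι) : ℕ := #{T : SimpleGraph ι | T.IsTree ∧ F ≤ T}

/-- Cross pairs. -/
noncomputable def CP (F : SimpleGraph ι) : Finset (ι × ι) := {p | ¬ F.Reachable p.1 p.2}

lemma cross_count (n : ℕ) (F T : SimpleGraph ι) [Fintype F.ConnectedComponent]
    (hF : F.IsAcyclic) (h : Fintype.card F.ConnectedComponent = n + 1) (hT : T.IsTree)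
    (hle : F ≤ T) : #{p ∈ CP F | T.Adj p.1 p.2} = 2 * n := by
  have e1 := edges_forest n F hF h
  have e2 := hT.card_edgeFinset
  have a1 := adj_count F
  have a2 := adj_count T
  have key : #{p : ι × ι | T.Adj p.1 p.2} =
      #{p ∈ CP F | T.Adj p.1 p.2} + #{p : ι × ι | F.Adj p.1 p.2} := by
    rw [← card_union_of_disjoint]
    · congr 1
      ext ⟨x, y⟩
      simp only [CP, mem_filter, mem_univ, true_and, mem_union]
      constructor
      · intro hxy
        by_cases hr : F.Reachable x y
        · right
          have hac : (F ⊔ edge x y).IsAcyclic :=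
            hT.isAcyclic.anti (sup_le hle ((edge_le_iff _).2 (Or.inr hxy)))
          exact ((isAcyclic_sup_fromEdgeSet_iff.1 hac).2 hr).resolve_left hxy.ne
        · exact Or.inl ⟨hr, hxy⟩
      · rintro (h | h)
        · exact h.2
        · exact hle h
    · rw [Finset.disjoint_left]
      rintro ⟨x, y⟩ h1 h2
      simp only [CP, mem_filter, mem_univ, true_and] at h1 h2
      exact h1.1 h2.reachable
  omega

lemma double_count (n : ℕ) (F : SimpleGraph ι) [Fintype F.ConnectedComponent]
    (hF : F.IsAcyclic) (h : Fintype.card F.ConnectedComponent = n + 1) :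
    2 * n * NT F = ∑ p ∈ CP F, NT (F ⊔ edge p.1 p.2) := by
  have h1 := Finset.sum_card_bipartiteAbove_eq_sum_card_bipartiteBelow
    (s := ({T : SimpleGraph ι | T.IsTree ∧ F ≤ T} : Finset _)) (t := CP F)
    (fun T p => T.Adj p.1 p.2)
  have h2 : ∀ T ∈ ({T : SimpleGraph ι | T.IsTree ∧ F ≤ T} : Finset _),
      #(bipartiteAbove (fun (T : SimpleGraph ι) (p : ι × ι) => T.Adj p.1 p.2) (CP F) T) = 2 * n := by
    intro T hT
    simp only [mem_filter, mem_univ, true_and] at hT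
    exact cross_count n F T hF h hT.1 hT.2
  rw [sum_congr rfl h2, sum_const, smul_eq_mul] at h1
  rw [NT, mul_comm, h1]
  refine sum_congr rfl fun p hp => ?_
  rw [NT, bipartiteBelow, filter_filter]
  congr 1
  ext T
  have : p.1 ≠ p.2 := by
    intro h
    simp [CP, h] at hp
  simp only [mem_filter, mem_univ, true_and, sup_le_iff, edge_le_iff, this, false_or, and_assoc]

lemma sum_inv (F : SimpleGraph ι) [Fintype F.ConnectedComponent] (u : ι) :
    ∑ v with ¬ F.Reachable u v, (1 : ℚ) / rs F (F.connectedComponentMk v) =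
      Fintype.card F.ConnectedComponent - 1 := by
  have h0 : ∀ c : F.ConnectedComponent,
      ∑ v with F.connectedComponentMk v = c, (1 : ℚ) / rs F (F.connectedComponentMk v) = 1 := by
    intro c
    have : ∀ v ∈ ({v | F.connectedComponentMk v = c} : Finset ι),
        (1 : ℚ) / rs F (F.connectedComponentMk v) = 1 / rs F c := by
      intro v hv
      rw [(mem_filter.1 hv).2]
    rw [sum_congr rfl this, sum_const, ← rs_eq, nsmul_eq_mul]
    have := rs_pos F c
    field_simp
  have h1 : ∑ v, (1 : ℚ) / rs F (F.connectedComponentMk v) =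
      Fintype.card F.ConnectedComponent := by
    rw [← Finset.sum_fiberwise univ F.connectedComponentMk, sum_congr rfl (fun c _ => h0 c)]
    simp
  have h2 := Finset.sum_filter_add_sum_filter_not univ (fun v => F.Reachable u v)
    (fun v => (1 : ℚ) / rs F (F.connectedComponentMk v))
  have h3 := h0 (F.connectedComponentMk u)
  have h4 : (univ.filter fun v => F.connectedComponentMk v = F.connectedComponentMk u) =
      univ.filter fun v => F.Reachable u v := by
    ext v; simp [F.reachable_comm]
  rw [h4] at h3
  linarith

lemma sum_cross (F : SimpleGraph ι) [Fintype F.ConnectedComponent] :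
    ∑ p ∈ CP F, ((1 : ℚ) / rs F (F.connectedComponentMk p.1) +
      1 / rs F (F.connectedComponentMk p.2)) =
    2 * Fintype.card ι * (Fintype.card F.ConnectedComponent - 1) := by
  have hb : ∑ p ∈ CP F, ((1 : ℚ) / rs F (F.connectedComponentMk p.2)) =
      Fintype.card ι * (Fintype.card F.ConnectedComponent - 1) := by
    rw [CP, sum_filter, ← Finset.univ_product_univ, sum_product]
    simp_rw [← sum_filter, sum_inv]
    simp [mul_sub]
  have ha : ∑ p ∈ CP F, ((1 : ℚ) / rs F (F.connectedComponentMk p.1)) =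
      ∑ p ∈ CP F, ((1 : ℚ) / rs F (F.connectedComponentMk p.2)) := by
    refine sum_nbij' Prod.swap Prod.swap ?_ ?_ ?_ ?_ ?_ <;>
      simp [CP, F.reachable_comm]
  rw [sum_add_distrib, ha, hb]
  ring

lemma main (n : ℕ) : ∀ (F : SimpleGraph ι) [Fintype F.ConnectedComponent],
    F.IsAcyclic → Fintype.card F.ConnectedComponent = n + 1 →
    (Fintype.card ι : ℚ) ^ 2 * NT F = (Fintype.card ι : ℚ) ^ (n + 1) * ∏ c, (rs F c : ℚ) := by
  induction n with
  | zero =>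
    intro F _ hF h
    have hc := conn_of_card_one F h
    have hT : F.IsTree := ⟨hc, hF⟩
    have h1 : NT F = 1 := by
      rw [NT, card_eq_one]
      refine ⟨F, ?_⟩
      ext T
      simp only [mem_filter, mem_univ, true_and, mem_singleton]
      constructor
      · rintro ⟨h1, h2⟩
        have := hc.nonempty
        exact le_antisymm ((maximal_isAcyclic_iff_isTree.2 hT).2 h1.isAcyclic h2) h2
      · rintro rfl; exact ⟨hT, le_rfl⟩
    have h2 : ∀ c, rs F c = Fintype.card ι := by
      intro c
      obtain ⟨y, rfl⟩ := ex_mk c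
      rw [rs_eq, filter_true_of_mem, card_univ]
      intro x _
      exact ConnectedComponent.eq.2 (hc.preconnected x y)
    simp only [h1, h2, prod_const, card_univ, h]
    ring
  | succ n ih =>
    intro F _ hF h
    have hdc := double_count (n + 1) F hF h
    have hs := sum_cross F
    have hcard : (Fintype.card F.ConnectedComponent : ℚ) = n + 2 := by rw [h]; push_cast; ring
    have hterm : ∀ p ∈ CP F, (Fintype.card ι : ℚ) ^ 2 * NT (F ⊔ edge p.1 p.2) =
        (Fintype.card ι : ℚ) ^ (n + 1) * (∏ c, (rs F c : ℚ)) *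
          ((1 : ℚ) / rs F (F.connectedComponentMk p.1) +
            1 / rs F (F.connectedComponentMk p.2)) := by
      rintro ⟨u, v⟩ hp
      have huv : ¬ F.Reachable u v := by simpa [CP] using hp
      have : Fintype (F ⊔ edge u v).ConnectedComponent := Fintype.ofFinite _
      have hm := prod_merge F huv
      have h1 := ih (F ⊔ edge u v) (hF.sup_edge_of_not_reachable huv)
        (by have := card_merge F huv; omega)
      have p1 : (rs F (F.connectedComponentMk u) : ℚ) ≠ 0 := by
        exact_mod_cast (rs_pos F _).ne'
      have p2 : (rs F (F.connectedComponentMk v) : ℚ) ≠ 0 := by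
        exact_mod_cast (rs_pos F _).ne'
      have hm' : (rs F (F.connectedComponentMk u) : ℚ) * rs F (F.connectedComponentMk v) *
          ∏ c, (rs (F ⊔ edge u v) c : ℚ) =
          (rs F (F.connectedComponentMk u) + rs F (F.connectedComponentMk v)) *
            ∏ c, (rs F c : ℚ) := by exact_mod_cast hm
      simp only
      rw [h1, mul_assoc]
      congr 1
      rw [div_add_div _ _ p1 p2, ← mul_div_assoc, eq_div_iff (mul_ne_zero p1 p2)]
      linear_combination hm'
    have hdc' : 2 * ((n : ℚ) + 1) * NT F = ∑ p ∈ CP F, (NT (F ⊔ edge p.1 p.2) : ℚ) := by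
      exact_mod_cast hdc
    have e : 2 * ((n : ℚ) + 1) * ((Fintype.card ι : ℚ) ^ 2 * NT F) =
        2 * ((n : ℚ) + 1) * ((Fintype.card ι : ℚ) ^ (n + 1 + 1) * ∏ c, (rs F c : ℚ)) := by
      calc _ = (Fintype.card ι : ℚ) ^ 2 * (2 * ((n : ℚ) + 1) * NT F) := by ring
        _ = _ := by
          rw [hdc', mul_sum, sum_congr rfl hterm, ← mul_sum, hs, hcard]
          ring
    have : 2 * ((n : ℚ) + 1) ≠ 0 := by positivity
    exact mul_left_cancel₀ this e

end GenCayley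

/-- Generalized Cayley formula: given a forest `F` on `p` labeled vertices with
`q ≥ 2` components of sizes `r₁, …, r_q`, the number of trees on the `p` vertices
containing `F` as a subgraph is `p^(q-2) * ∏ᵢ rᵢ`. -/
theorem stmt9 {ι : Type*} [Fintype ι] [DecidableEq ι] (F : SimpleGraph ι)
    (hF : F.IsAcyclic) [Fintype F.ConnectedComponent]
    (hq : 2 ≤ Fintype.card F.ConnectedComponent) :
    Nat.card {T : SimpleGraph ι // T.IsTree ∧ F ≤ T} =
      Fintype.card ι ^ (Fintype.card F.ConnectedComponent - 2) *
        ∏ c : F.ConnectedComponent, Nat.card {x : ι // F.connectedComponentMk x = c} := by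
  classical
  obtain ⟨n, hn⟩ := Nat.exists_eq_add_of_le hq
  have h := GenCayley.main (n + 1) F hF (by omega)
  have hN : Nat.card {T : SimpleGraph ι // T.IsTree ∧ F ≤ T} = GenCayley.NT F := by
    rw [GenCayley.NT, Nat.card_eq_fintype_card, Fintype.card_subtype]
    congr!
  have hp : (Fintype.card ι : ℚ) ≠ 0 := by
    have : Nonempty F.ConnectedComponent := Fintype.card_pos_iff.1 (by omega)
    have : Nonempty ι := ⟨this.some.exists_rep.choose⟩
    exact_mod_cast Fintype.card_ne_zero
  have hres : (GenCayley.NT F : ℚ) = (Fintype.card ι : ℚ) ^ n * ∏ c, (GenCayley.rs F c : ℚ) := by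
    apply mul_left_cancel₀ (pow_ne_zero 2 hp)
    rw [h]
    ring
  rw [hN, hn, Nat.add_sub_cancel_left]
  have : GenCayley.NT F = Fintype.card ι ^ n * ∏ c, GenCayley.rs F c := by exact_mod_cast hres
  exact this
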